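/- Fix α ∈ ℝ and let 1/z_n = 1 + α n^{-1/2}. Then L_n/√n + α converges in distribution to a standard normal conditioned to exceed α: for every y ≥ α, P_{n,z_n}(L_n/√n + α > y) → Φ̄(y)/Φ̄(α). -/

import Mathlib

open Filter Finset Real

/-- Number of `k`-step SAWs weight: `(z/n)^k` times the number of walks. -/
noncomputable def sawWeight (n : ℕ) (z : ℝ) (k : ℕ) : ℝ :=
  (z / n) ^ k * ((n - 1).descFactorial k)

/-- Partition function of the variable-length SAW model on `K_n`. -/
noncomputable def sawZ (n : ℕ) (z : ℝ) : ℝ := ∑ k ∈ Finset.range n, sawWeight n z k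

/-- Probability that the walk length equals `k`. -/
noncomputable def sawProb (n : ℕ) (z : ℝ) (k : ℕ) : ℝ := sawWeight n z k / sawZ n z

/-- Mean walk length. -/
noncomputable def sawMean (n : ℕ) (z : ℝ) : ℝ := ∑ k ∈ Finset.range n, (k : ℝ) * sawProb n z k

/-- Variance of the walk length. -/
noncomputable def sawVar (n : ℕ) (z : ℝ) : ℝ :=
  (∑ k ∈ Finset.range n, (k : ℝ) ^ 2 * sawProb n z k) - (sawMean n z) ^ 2

/-- Tail distribution `P(L_n > x)` for real `x`. -/
noncomputable def sawTail (n : ℕ) (z : ℝ) (x : ℝ) : ℝ :=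
  ∑ k ∈ Finset.range n, if x < (k : ℝ) then sawProb n z k else 0

/-- Regularised incomplete gamma function at integer first argument,
    `Q(n, ν) = e^{-ν} ∑_{j<n} ν^j/j!`. -/
noncomputable def Qreg (n : ℕ) (ν : ℝ) : ℝ :=
  Real.exp (-ν) * ∑ j ∈ Finset.range n, ν ^ j / (Nat.factorial j)

/-- `H_n(ν) = Γ(n) Q(n,ν) / (ν^n e^{-ν})`. -/
noncomputable def Hfun (n : ℕ) (ν : ℝ) : ℝ :=
  Real.Gamma n * Qreg n ν / (ν ^ n * Real.exp (-ν))

/-- Standard normal density. -/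
noncomputable def normpdf (x : ℝ) : ℝ := Real.exp (-x ^ 2 / 2) / Real.sqrt (2 * Real.pi)

/-- Standard normal tail distribution `Φ̄`. -/
noncomputable def normTail (x : ℝ) : ℝ := ∫ t in Set.Ioi x, normpdf t

/-- `η(λ) = sgn(λ-1) √(2(λ-1-log λ))`. -/
noncomputable def etaF (l : ℝ) : ℝ := Real.sign (l - 1) * Real.sqrt (2 * (l - 1 - Real.log l))

/-- `Γ*(n) = √(n/(2π)) e^n n^{-n} Γ(n)`. -/
noncomputable def gammaStar (n : ℕ) : ℝ :=
  Real.sqrt (n / (2 * Real.pi)) * Real.exp n * ((n : ℝ) ^ n)⁻¹ * Real.Gamma n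

/-- The operator `(ν d/dν)^l`. -/
noncomputable def thetaOp : ℕ → (ℝ → ℝ) → (ℝ → ℝ)
  | 0, f => f
  | (l + 1), f => fun ν => ν * deriv (thetaOp l f) ν

/-- The fugacity `z_n` in the boundary window, `1 / z_n = 1 + α n^{-1/2}`. -/
noncomputable def boundaryFugacity (α : ℝ) (n : ℕ) : ℝ := 1 / (1 + α / Real.sqrt n)

theorem sawWeight_zero (n : ℕ) (z : ℝ) : sawWeight n z 0 = 1 := by
  simp [sawWeight]

theorem sawWeight_succ (n : ℕ) (z : ℝ) (k : ℕ) :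
    sawWeight n z (k + 1) = sawWeight n z k * (z * (((n - 1 - k : ℕ) : ℝ) / n)) := by
  simp only [sawWeight, Nat.descFactorial_succ, pow_succ]
  push_cast
  ring

theorem sawWeight_eq_zero {n k : ℕ} (hn : 0 < n) (z : ℝ) (hk : n ≤ k) : sawWeight n z k = 0 := by
  have : (n - 1).descFactorial k = 0 := Nat.descFactorial_eq_zero_iff_lt.2 (by omega)
  simp [sawWeight, this]

theorem sawWeight_nonneg (n : ℕ) {z : ℝ} (hz : 0 ≤ z) (k : ℕ) : 0 ≤ sawWeight n z k := by
  unfold sawWeight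
  positivity

theorem sawWeight_le_exp {n : ℕ} (hn : 0 < n) {u : ℝ} (hu : 0 < 1 + u) (k : ℕ) :
    sawWeight n (1 / (1 + u)) k ≤ exp (-(k * (u / (1 + u))) - k * (k + 1) / (2 * n)) := by
  have hn' : (0 : ℝ) < n := by exact_mod_cast hn
  induction k with
  | zero => simp [sawWeight_zero]
  | succ k ih =>
    have h1 : 1 / (1 + u) ≤ exp (-(u / (1 + u))) := by
      refine le_trans (le_of_eq ?_) (add_one_le_exp _)
      field_simp
      ring
    have h2 : ((n - 1 - k : ℕ) : ℝ) / n ≤ exp (-((k + 1) / n)) := by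
      rcases le_or_gt (k + 1) n with h | h
      · refine le_trans (le_of_eq ?_) (add_one_le_exp _)
        rw [Nat.sub_sub, Nat.cast_sub (by omega)]
        push_cast
        field_simp
        ring
      · rw [show n - 1 - k = 0 by omega]
        simpa using (exp_pos _).le
    rw [sawWeight_succ]
    calc _ ≤ exp (-(k * (u / (1 + u))) - k * (k + 1) / (2 * n)) *
          (exp (-(u / (1 + u))) * exp (-((k + 1) / n))) := by
            gcongr
      _ = _ := by
        rw [← exp_add, ← exp_add]
        congr 1
        push_cast
        field_simp
        ring

theorem exp_le_sawWeight {n m : ℕ} (hm : m < n) {u : ℝ} (hu : 0 < 1 + u) {k : ℕ} (hk : k ≤ m) :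
    exp (-(k * u) - k * (k + 1) / (2 * (n - m))) ≤ sawWeight n (1 / (1 + u)) k := by
  have hm' : (0 : ℝ) < n - m := sub_pos.2 (by exact_mod_cast hm)
  have hn' : (0 : ℝ) < n := by exact_mod_cast (Nat.zero_le m).trans_lt hm
  induction k with
  | zero => simp [sawWeight_zero]
  | succ k ih =>
    have h1 : exp (-u) ≤ 1 / (1 + u) := by
      rw [exp_neg, ← one_div]
      gcongr
      linarith [add_one_le_exp u]
    have hkm : (k : ℝ) + 1 ≤ m := by exact_mod_cast hk
    have hkn : (0 : ℝ) < n - (k + 1) := by linarith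
    have h2 : exp (-((k + 1) / (n - m))) ≤ ((n - 1 - k : ℕ) : ℝ) / n := by
      have hexp : n / (n - (k + 1)) ≤ exp ((k + 1) / ((n : ℝ) - m)) := by
        calc (n : ℝ) / (n - (k + 1)) = (k + 1) / (n - (k + 1)) + 1 := by
              field_simp
              ring
          _ ≤ (k + 1) / (n - m) + 1 := by gcongr
          _ ≤ _ := add_one_le_exp _
      have hcast : ((n - 1 - k : ℕ) : ℝ) = n - (k + 1) := by
        rw [Nat.sub_sub, Nat.cast_sub (by omega)]
        push_cast
        ring
      rw [hcast, exp_neg, ← inv_div (n : ℝ) (n - (k + 1))]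
      gcongr
    rw [sawWeight_succ]
    calc _ = exp (-(k * u) - k * (k + 1) / (2 * (n - m))) *
          (exp (-u) * exp (-((k + 1) / (n - m)))) := by
            rw [← exp_add, ← exp_add]
            congr 1
            push_cast
            field_simp
            ring
      _ ≤ _ := by
        gcongr
        · exact (exp_pos _).le.trans (ih (by omega))
        · exact ih (by omega)

/-- Riemann sums of mesh `1 / √n` as integrals of step functions. -/
theorem integral_floor_mul_sqrt {n : ℕ} (hn : 0 < n) {h : ℕ → ℝ} (hh : ∀ k, n ≤ k → h k = 0) :
    ∫ x in Set.Ici (0 : ℝ), h ⌊x * √n⌋₊ = (∑ k ∈ Finset.range n, h k) / √n := by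
  have hs : 0 < √(n : ℝ) := Real.sqrt_pos.2 (by exact_mod_cast hn)
  have hset : ∀ k : ℕ, ∀ x ∈ Set.Ici (0 : ℝ),
      x ∈ Set.Ico (k / √(n : ℝ)) ((k + 1) / √n) ↔ ⌊x * √n⌋₊ = k := by
    intro k x hx
    rw [Nat.floor_eq_iff (mul_nonneg hx hs.le), Set.mem_Ico, div_le_iff₀ hs, lt_div_iff₀ hs]
  have hfun : Set.EqOn (fun x => h ⌊x * √n⌋₊)
      (fun x => ∑ k ∈ Finset.range n,
        (Set.Ico (k / √(n : ℝ)) ((k + 1) / √n)).indicator (fun _ => h k) x) (Set.Ici 0) := by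
    intro x hx
    classical
    simp only [Set.indicator_apply, hset _ x hx]
    rw [Finset.sum_ite_eq]
    split_ifs with hmem
    · rfl
    · exact hh _ (by simpa using hmem)
  rw [MeasureTheory.setIntegral_congr_fun measurableSet_Ici hfun,
    MeasureTheory.integral_finsetSum, Finset.sum_div]
  · refine Finset.sum_congr rfl fun k _ => ?_
    have hsub : Set.Ici (0 : ℝ) ∩ Set.Ico (k / √(n : ℝ)) ((k + 1) / √n) =
        Set.Ico (k / √(n : ℝ)) ((k + 1) / √n) :=
      Set.inter_eq_right.2 fun x hx => le_trans (by positivity) hx.1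
    rw [MeasureTheory.setIntegral_indicator measurableSet_Ico, hsub,
      MeasureTheory.setIntegral_const, MeasureTheory.measureReal_def, Real.volume_Ico,
      ENNReal.toReal_ofReal (by rw [sub_nonneg]; gcongr; linarith)]
    simp only [smul_eq_mul]
    ring
  · intro k _
    refine MeasureTheory.Integrable.integrableOn ?_
    exact (MeasureTheory.integrable_indicator_iff measurableSet_Ico).2
      (MeasureTheory.integrableOn_const (by simp))

theorem tendsto_sqrt_natCast : Tendsto (fun n : ℕ => √(n : ℝ)) atTop atTop :=
  tendsto_sqrt_atTop.comp tendsto_natCast_atTop_atTop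

theorem tendsto_floor_mul_sqrt_div {x : ℝ} (hx : 0 ≤ x) :
    Tendsto (fun n : ℕ => (⌊x * √n⌋₊ : ℝ) / √n) atTop (nhds x) :=
  (tendsto_nat_floor_mul_div_atTop hx).comp tendsto_sqrt_natCast

theorem eventually_abs_div_sqrt_le (α : ℝ) : ∀ᶠ n : ℕ in atTop, |α / √n| ≤ 1 / 2 := by
  have h := (tendsto_sqrt_natCast.const_div_atTop α).abs
  rw [abs_zero] at h
  exact (h.eventually_lt_const (by norm_num : (0 : ℝ) < 1 / 2)).mono fun n hn => hn.le

theorem tendsto_sawWeight_floor (α : ℝ) {x : ℝ} (hx : 0 ≤ x) :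
    Tendsto (fun n : ℕ => sawWeight n (boundaryFugacity α n) ⌊x * √n⌋₊) atTop
      (nhds (exp (-(α * x) - x ^ 2 / 2))) := by
  have hk := tendsto_floor_mul_sqrt_div hx
  have hr : Tendsto (fun n : ℕ => 1 / √(n : ℝ)) atTop (nhds 0) :=
    tendsto_sqrt_natCast.const_div_atTop 1
  have hu : Tendsto (fun n : ℕ => 1 + α / √(n : ℝ)) atTop (nhds (1 + 0)) :=
    (tendsto_sqrt_natCast.const_div_atTop α).const_add 1
  have hkr : Tendsto (fun n : ℕ => 1 - (⌊x * √n⌋₊ : ℝ) / √n * (1 / √n)) atTop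
      (nhds (1 - x * 0)) := (hk.mul hr).const_sub 1
  have hpos : ∀ᶠ n : ℕ in atTop, 0 < n := eventually_gt_atTop 0
  have hlow : Tendsto (fun n : ℕ => exp (-(α * ((⌊x * √n⌋₊ : ℝ) / √n)) -
      (⌊x * √n⌋₊ : ℝ) / √n * ((⌊x * √n⌋₊ : ℝ) / √n + 1 / √n) /
        (2 * (1 - (⌊x * √n⌋₊ : ℝ) / √n * (1 / √n))))) atTop
      (nhds (exp (-(α * x) - x ^ 2 / 2))) := by
    have h := ((hk.const_mul α).neg.sub ((hk.mul (hk.add hr)).div (hkr.const_mul 2)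
      (by norm_num))).rexp
    convert h using 3
    · rfl
    · ring
  have hup : Tendsto (fun n : ℕ => exp (-(α * ((⌊x * √n⌋₊ : ℝ) / √n) / (1 + α / √n)) -
      (⌊x * √n⌋₊ : ℝ) / √n * ((⌊x * √n⌋₊ : ℝ) / √n + 1 / √n) / 2)) atTop
      (nhds (exp (-(α * x) - x ^ 2 / 2))) := by
    have h := ((((hk.const_mul α).div hu (by norm_num)).neg).sub
      ((hk.mul (hk.add hr)).div_const 2)).rexp
    convert h using 3
    · rfl
    · ring
  refine tendsto_of_tendsto_of_tendsto_of_le_of_le' hlow hup ?_ ?_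
  · filter_upwards [hpos, hu.eventually_const_lt (by norm_num : (0 : ℝ) < 1 + 0),
      hkr.eventually_const_lt (by norm_num : (0 : ℝ) < 1 - x * 0)] with n hn hun hkn
    have hs : 0 < √(n : ℝ) := Real.sqrt_pos.2 (by exact_mod_cast hn)
    have hsq : (n : ℝ) = √n * √n := (Real.mul_self_sqrt (Nat.cast_nonneg n)).symm
    have hlt : ⌊x * √n⌋₊ < n := by
      rw [div_mul_div_comm, mul_one, ← hsq, sub_pos, div_lt_one (by exact_mod_cast hn)] at hkn
      exact_mod_cast hkn
    refine le_trans (le_of_eq ?_) (exp_le_sawWeight hlt hun le_rfl)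
    generalize ⌊x * √n⌋₊ = k at *
    congr 1
    have hkn' : (0 : ℝ) < n - k := sub_pos.2 (by exact_mod_cast hlt)
    rw [hsq] at hkn'
    rw [show (2 * ((n : ℝ) - k)) = 2 * (√n * √n - k) by rw [← hsq]]
    have : 1 - (k : ℝ) / √n * (1 / √n) = (√n * √n - k) / (√n * √n) := by field_simp
    rw [this]
    field_simp
  · filter_upwards [hpos, hu.eventually_const_lt (by norm_num : (0 : ℝ) < 1 + 0)] with n hn hun
    have hs : 0 < √(n : ℝ) := Real.sqrt_pos.2 (by exact_mod_cast hn)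
    have hsq : (n : ℝ) = √n * √n := (Real.mul_self_sqrt (Nat.cast_nonneg n)).symm
    refine (sawWeight_le_exp hn hun _).trans (le_of_eq ?_)
    generalize ⌊x * √n⌋₊ = k at *
    congr 1
    rw [show (2 * (n : ℝ)) = 2 * (√n * √n) by rw [← hsq]]
    field_simp

theorem sawWeight_floor_le {α : ℝ} {n : ℕ} (hn : 0 < n) (hα : |α / √n| ≤ 1 / 2) {x : ℝ}
    (hx : 0 ≤ x) :
    sawWeight n (boundaryFugacity α n) ⌊x * √n⌋₊ ≤
      exp (4 * α ^ 2 + 1 / 4) * exp (-(1 / 8) * x ^ 2) := by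
  have hn1 : (1 : ℝ) ≤ n := by exact_mod_cast hn
  have hs : 1 ≤ √(n : ℝ) := Real.one_le_sqrt.2 hn1
  have hs0 : 0 < √(n : ℝ) := by linarith
  have hsq : (n : ℝ) = √n * √n := (Real.mul_self_sqrt (Nat.cast_nonneg n)).symm
  have hu : 1 / 2 ≤ 1 + α / √n := by linarith [neg_abs_le (α / √n)]
  refine (sawWeight_le_exp hn (by linarith) _).trans ?_
  rw [← exp_add]
  apply exp_le_exp.2
  have hfl : x * √n < ⌊x * √n⌋₊ + 1 := Nat.lt_floor_add_one _
  generalize ⌊x * √n⌋₊ = k at *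
  set s : ℝ := k / √n with hsdef
  have hk : (k : ℝ) = s * √n := by rw [hsdef]; field_simp
  have hs_nonneg : 0 ≤ s := by positivity
  have hxs : x ≤ s + 1 := by
    by_contra! hlt
    nlinarith
  have h1 : -(k * (α / √n / (1 + α / √n))) ≤ 2 * |α| * s := by
    have habs : |α / √n / (1 + α / √n)| ≤ 2 * (|α| / √n) := by
      rw [abs_div, abs_div, abs_of_pos hs0, abs_of_pos (show 0 < 1 + α / √n by linarith),
        div_le_iff₀ (by linarith)]
      have : 0 ≤ |α| / √n := by positivity
      nlinarith
    have hk0 : (0 : ℝ) ≤ k := Nat.cast_nonneg k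
    calc -(k * (α / √n / (1 + α / √n))) = k * -(α / √n / (1 + α / √n)) := by ring
      _ ≤ k * (2 * (|α| / √n)) := by
        gcongr
        exact (neg_le_abs _).trans habs
      _ = 2 * |α| * s := by rw [hsdef]; ring
  have h2 : s ^ 2 / 2 ≤ k * (k + 1) / (2 * n) := by
    rw [hk, div_le_div_iff₀ (by norm_num) (by positivity)]
    nlinarith [mul_nonneg hs_nonneg hs0.le]
  have h3 : x ^ 2 ≤ 2 * s ^ 2 + 2 := by nlinarith [sq_nonneg (s - 1)]
  nlinarith [sq_nonneg (s / 2 - 2 * |α|), sq_abs α]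

theorem tendsto_sum_sawWeight_div_sqrt (α c : ℝ) :
    Tendsto (fun n : ℕ => (∑ k ∈ Finset.range n,
        if c * √n < k then sawWeight n (boundaryFugacity α n) k else 0) / √n) atTop
      (nhds (∫ x in Set.Ioi (max 0 c), exp (-(α * x) - x ^ 2 / 2))) := by
  have key : Tendsto (fun n : ℕ => ∫ x in Set.Ici (0 : ℝ),
      (fun k : ℕ => if c * √n < k then sawWeight n (boundaryFugacity α n) k else 0) ⌊x * √n⌋₊)
      atTop (nhds (∫ x in Set.Ici (0 : ℝ),
        (Set.Ioi c).indicator (fun x => exp (-(α * x) - x ^ 2 / 2)) x)) := by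
    refine MeasureTheory.tendsto_integral_filter_of_dominated_convergence
      (fun x => exp (4 * α ^ 2 + 1 / 4) * exp (-(1 / 8) * x ^ 2)) ?_ ?_ ?_ ?_
    · refine Eventually.of_forall fun n => Measurable.aestronglyMeasurable ?_
      exact (measurable_of_countable fun k : ℕ =>
        if c * √n < k then sawWeight n (boundaryFugacity α n) k else 0).comp
          (Nat.measurable_floor.comp (measurable_id.mul_const √(n : ℝ)))
    · filter_upwards [eventually_gt_atTop 0, eventually_abs_div_sqrt_le α] with n hn hα
      refine (MeasureTheory.ae_restrict_iff' measurableSet_Ici).2 (Eventually.of_forall fun x hx => ?_)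
      have hz : 0 ≤ boundaryFugacity α n :=
        one_div_nonneg.2 (by linarith [neg_abs_le (α / √n)])
      split_ifs
      · rw [Real.norm_of_nonneg (sawWeight_nonneg n hz _)]
        exact sawWeight_floor_le hn hα hx
      · rw [norm_zero]
        positivity
    · exact ((integrable_exp_neg_mul_sq (by norm_num)).const_mul _).integrableOn
    · have hne : ∀ᵐ x : ℝ, x ≠ c := by simp [MeasureTheory.ae_iff]
      refine (MeasureTheory.ae_restrict_iff' measurableSet_Ici).2 (hne.mono fun x hxc hx => ?_)
      have hk := tendsto_floor_mul_sqrt_div hx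
      have hiff : ∀ n : ℕ, 0 < n →
          (c < (⌊x * √n⌋₊ : ℝ) / √n ↔ c * √n < ⌊x * √n⌋₊) := fun n hn =>
        lt_div_iff₀ (Real.sqrt_pos.2 (by exact_mod_cast hn))
      rcases lt_or_gt_of_ne hxc with hlt | hgt
      · rw [Set.indicator_of_notMem (by simpa using hlt.le)]
        refine tendsto_const_nhds.congr' ?_
        filter_upwards [eventually_gt_atTop 0, hk.eventually_lt_const hlt] with n hn hkn
        rw [if_neg ((hiff n hn).not.1 hkn.not_gt)]
      · rw [Set.indicator_of_mem (Set.mem_Ioi.2 hgt)]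
        refine (tendsto_sawWeight_floor α hx).congr' ?_
        filter_upwards [eventually_gt_atTop 0, hk.eventually_const_lt hgt] with n hn hkn
        rw [if_pos ((hiff n hn).1 hkn)]
  rw [MeasureTheory.setIntegral_indicator measurableSet_Ioi,
    ← MeasureTheory.setIntegral_congr_set
      ((MeasureTheory.Ioi_ae_eq_Ici (μ := MeasureTheory.volume)).inter
        (Filter.EventuallyEq.refl _ (Set.Ioi c))), Set.Ioi_inter_Ioi] at key
  refine key.congr' ?_
  filter_upwards [eventually_gt_atTop 0] with n hn
  refine integral_floor_mul_sqrt
    (h := fun k : ℕ => if c * √n < k then sawWeight n (boundaryFugacity α n) k else 0)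
    hn fun k hk => ?_
  rw [sawWeight_eq_zero hn _ hk, ite_self]

theorem integral_Ioi_exp_eq_normTail (α c : ℝ) :
    ∫ x in Set.Ioi c, exp (-(α * x) - x ^ 2 / 2) =
      exp (α ^ 2 / 2) * √(2 * π) * normTail (c + α) := by
  have hpi : 0 < √(2 * π) := by positivity
  rw [normTail, ← MeasureTheory.integral_const_mul,
    ← MeasureTheory.integral_indicator measurableSet_Ioi,
    ← MeasureTheory.integral_indicator measurableSet_Ioi,
    ← MeasureTheory.integral_add_right_eq_self ((Set.Ioi (c + α)).indicator _) α]
  congr 1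
  ext x
  simp only [Set.indicator_apply, Set.mem_Ioi, add_lt_add_iff_right]
  split_ifs
  · rw [normpdf, mul_assoc, mul_div_cancel₀ _ hpi.ne', ← exp_add]
    congr 1
    ring
  · rfl

theorem normTail_pos (a : ℝ) : 0 < normTail a := by
  have hint : MeasureTheory.Integrable normpdf := by
    have h := (integrable_exp_neg_mul_sq (by norm_num : (0 : ℝ) < 1 / 2)).div_const (√(2 * π))
    refine h.congr (Eventually.of_forall fun x => ?_)
    simp only [normpdf]
    ring_nf
  have hpos : ∀ x, 0 < normpdf x := fun x => by
    unfold normpdf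
    positivity
  rw [normTail, MeasureTheory.setIntegral_pos_iff_support_of_nonneg_ae
    (Eventually.of_forall fun x => (hpos x).le) hint.integrableOn]
  rw [Function.support_eq_univ fun x => (hpos x).ne']
  simp

theorem sawTail_eq_div (n : ℕ) (z x : ℝ) :
    sawTail n z x = (∑ k ∈ Finset.range n, if x < k then sawWeight n z k else 0) / sawZ n z := by
  rw [sawTail, Finset.sum_div]
  refine Finset.sum_congr rfl fun k _ => ?_
  split_ifs
  · rfl
  · rw [zero_div]

theorem boundary_conditioned_normal (α : ℝ) (y : ℝ) (hy : α ≤ y) :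
    Tendsto (fun n : ℕ => sawTail n (1 / (1 + α / Real.sqrt n)) ((y - α) * Real.sqrt n))
      atTop (nhds (normTail y / normTail α)) := by
  have hnum := tendsto_sum_sawWeight_div_sqrt α (y - α)
  have hden := tendsto_sum_sawWeight_div_sqrt α (-1)
  rw [max_eq_right (sub_nonneg.2 hy), integral_Ioi_exp_eq_normTail, sub_add_cancel] at hnum
  rw [max_eq_left (by norm_num), integral_Ioi_exp_eq_normTail, zero_add] at hden
  have hK : exp (α ^ 2 / 2) * √(2 * π) ≠ 0 := by positivity
  have hlim := hnum.div hden (mul_ne_zero hK (normTail_pos α).ne')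
  rw [mul_div_mul_left _ _ hK] at hlim
  refine hlim.congr' ?_
  filter_upwards [eventually_gt_atTop 0] with n hn
  have hs : 0 < √(n : ℝ) := Real.sqrt_pos.2 (by exact_mod_cast hn)
  have hZ : ∑ k ∈ Finset.range n,
      (if -1 * √(n : ℝ) < k then sawWeight n (boundaryFugacity α n) k else 0) =
      sawZ n (boundaryFugacity α n) := by
    refine Finset.sum_congr rfl fun k _ => if_pos ?_
    have : (0 : ℝ) ≤ k := Nat.cast_nonneg k
    linarith
  rw [Pi.div_apply, hZ, div_div_div_cancel_right₀ hs.ne', ← boundaryFugacity, ← sawTail_eq_div]
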